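/- arXiv:2304.00532 — 9 statements merged into one kernel-verified Lean document; each statement's English description precedes it below -/
import Mathlib

section
/- Let (A,+,·) be a left brace. Then A^{(2)} is contained in the kernel of λ (λ_z = id for all z ∈ A^{(2)}) if and only if λ is a group homomorphism from (A,+) to Aut(A,+), i.e. λ_{a+b} = λ_a ∘ λ_b for all a,b ∈ A. -/
/-- `λ_a(b) = -a + a·b` for a left-brace multiplication `mul`. -/
def braceLam {A : Type*} [AddCommGroup A] (mul : A → A → A) (a b : A) : A :=
  -a + mul a b

/-- The star operation `a * b = λ_a(b) - b`. -/
def braceStar {A : Type*} [AddCommGroup A] (mul : A → A → A) (a b : A) : A :=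
  braceLam mul a b - b

/-- `rightSeries mul r` is `A^{(r+1)}` of the paper: `rightSeries mul 0 = A^{(1)} = A` and
`rightSeries mul (r+1) = A^{(r+2)} = A^{(r+1)} * A`, the additive subgroup generated by
star products of elements of `A^{(r+1)}` with elements of `A`. -/
def rightSeries {A : Type*} [AddCommGroup A] (mul : A → A → A) : ℕ → AddSubgroup A
  | 0 => ⊤
  | r + 1 => AddSubgroup.closure {x | ∃ z c, z ∈ rightSeries mul r ∧ x = braceStar mul z c}

theorem mul_eq_add_braceLam {A : Type*} [AddCommGroup A] (mul : A → A → A) (a b : A) :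
    mul a b = a + braceLam mul a b := by
  simp [braceLam]

theorem braceLam_zero {A : Type*} [AddCommGroup A] {mul : A → A → A}
    (hzl : ∀ a : A, mul 0 a = a) (c : A) : braceLam mul 0 c = c := by
  simp [braceLam, hzl]

/-- In a left brace, `λ` is multiplicative: `λ_{a·b} = λ_a ∘ λ_b`. -/
theorem braceLam_mul {A : Type*} [AddCommGroup A] {mul : A → A → A}
    (hassoc : ∀ a b c : A, mul (mul a b) c = mul a (mul b c))
    (hdist : ∀ a b c : A, mul a (b + c) = mul a b - a + mul a c) (a b c : A) :
    braceLam mul (mul a b) c = braceLam mul a (braceLam mul b c) := by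
  have h := hdist a b (braceLam mul b c)
  rw [← mul_eq_add_braceLam, ← hassoc] at h
  rw [braceLam, h, braceLam.eq_def mul a (braceLam mul b c)]
  abel

theorem braceStar_mem_rightSeries_one {A : Type*} [AddCommGroup A] (mul : A → A → A) (a b : A) :
    braceStar mul a b ∈ rightSeries mul 1 :=
  AddSubgroup.subset_closure ⟨a, b, AddSubgroup.mem_top a, rfl⟩

/-- For a left brace `A`, `A^{(2)} ⊆ ker λ` (i.e. `λ_z = id` for all
`z ∈ A^{(2)}`) iff `λ` is a group homomorphism from `(A,+)` to `Aut(A,+)`,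
i.e. `λ_{a+b} = λ_a ∘ λ_b` for all `a, b ∈ A`. -/
theorem stmt1 {A : Type*} [AddCommGroup A]
    (mul : A → A → A)
    (hassoc : ∀ a b c : A, mul (mul a b) c = mul a (mul b c))
    (hzl : ∀ a : A, mul 0 a = a)
    (hzr : ∀ a : A, mul a 0 = a)
    (hinv : ∀ a : A, ∃ b : A, mul a b = 0 ∧ mul b a = 0)
    (hdist : ∀ a b c : A, mul a (b + c) = mul a b - a + mul a c)
    :
    (∀ z ∈ rightSeries mul 1, ∀ c : A, braceLam mul z c = c) ↔
      (∀ a b c : A, braceLam mul (a + b) c = braceLam mul a (braceLam mul b c)) := by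
  have hmul := braceLam_mul hassoc hdist
  have hzero := braceLam_zero hzl
  constructor
  · intro h a b c
    have hab : mul (braceStar mul a b) (a + b) = mul a b := by
      rw [mul_eq_add_braceLam mul (braceStar mul a b),
        h _ (braceStar_mem_rightSeries_one mul a b), mul_eq_add_braceLam mul a b, braceStar]
      abel
    rw [← hmul a b c, ← hab, hmul, h _ (braceStar_mem_rightSeries_one mul a b)]
  · intro h z hz
    refine AddSubgroup.closure_induction (p := fun z _ => ∀ c, braceLam mul z c = c)
      ?_ hzero ?_ ?_ hz
    · rintro _ ⟨a, b, -, rfl⟩ c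
      have hconj : ∀ d, braceLam mul (braceLam mul a b) d = braceLam mul b d := by
        intro d
        have hd := hmul a b d
        rw [mul_eq_add_braceLam mul a b, h] at hd
        simpa only [← h, neg_add_cancel_left] using congrArg (braceLam mul (-a)) hd
      have hc : c = braceLam mul b (braceLam mul (-b) c) := by
        rw [← h, add_neg_cancel, hzero]
      rw [hc, ← h, braceStar, sub_add_cancel, hconj]
    · intro x y _ _ hx hy c
      rw [h, hy, hx]
    · intro x _ hx c
      rw [← hx (braceLam mul (-x) c), ← h, add_neg_cancel, hzero]
end

section
/- Let (B,+) be an abelian group acting on itself via a group homomorphism λ : (B,+) → Aut(B,+) (so λ_{x+y} = λ_x ∘ λ_y), and suppose λ_{λ_y(x)} = λ_x for all x,y ∈ B. Define x·y = x + λ_x(y). Then (B,+,·) is a left brace: · is associative, 0 is a two-sided identity for ·, every x ∈ B has the ·-inverse −λ_x⁻¹(x), and x·(y+z) = x·y − x + x·z for all x,y,z ∈ B; moreover B^{(3)} = {0}. -/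
/-- The multiplication `x·y = x + λ_x(y)` built from an action `l` of an abelian group on
itself. -/
def actMul {B : Type*} [AddCommGroup B] (l : B → (B ≃+ B)) (x y : B) : B :=
  x + l x y

/-- An additive action is trivial at `0`. -/
theorem action_zero {B : Type*} [AddCommGroup B] (l : B → (B ≃+ B))
    (hhom : ∀ x y c : B, l (x + y) c = l x (l y c)) (c : B) : l 0 c = c := by
  apply (l 0).injective
  rw [← hhom, add_zero]

/-- An additive action sends `-x` to the inverse automorphism. -/
theorem action_neg {B : Type*} [AddCommGroup B] (l : B → (B ≃+ B))
    (hhom : ∀ x y c : B, l (x + y) c = l x (l y c)) (x c : B) :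
    l (-x) c = (l x).symm c := by
  apply (l x).injective
  rw [← hhom, add_neg_cancel, action_zero l hhom, AddEquiv.apply_symm_apply]

theorem braceStar_actMul {B : Type*} [AddCommGroup B] (l : B → (B ≃+ B)) (x y : B) :
    braceStar (actMul l) x y = l x y - y := by
  simp [braceStar, braceLam, actMul]

/-- The elements of `B^{(2)}` act trivially. -/
theorem action_eq_self_of_mem_rightSeries_one {B : Type*} [AddCommGroup B] (l : B → (B ≃+ B))
    (hhom : ∀ x y c : B, l (x + y) c = l x (l y c))
    (hinvar : ∀ x y c : B, l (l y x) c = l x c) {z : B}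
    (hz : z ∈ rightSeries (actMul l) 1) (c : B) : l z c = c := by
  change z ∈ AddSubgroup.closure _ at hz
  induction hz using AddSubgroup.closure_induction generalizing c with
  | mem z h =>
    obtain ⟨x, y, -, rfl⟩ := h
    rw [braceStar_actMul, sub_eq_add_neg, hhom, hinvar, ← hhom, add_neg_cancel,
      action_zero l hhom]
  | zero => exact action_zero l hhom c
  | add a b _ _ ha hb => rw [hhom, hb, ha]
  | neg a _ ha => rw [action_neg l hhom, AddEquiv.symm_apply_eq, ha]

/-- Theorem A: Let `(B,+)` be an abelian group acting on itself via a group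
homomorphism `λ : (B,+) → Aut(B,+)` with `λ_{λ_y(x)} = λ_x` for all `x, y ∈ B`, and define
`x·y = x + λ_x(y)`. Then `(B,+,·)` is a left brace: `·` is associative, `0` is a two-sided
identity, every `x` has the `·`-inverse `-λ_x⁻¹(x)`, the modified distributive law holds,
and moreover `B^{(3)} = {0}`. -/
theorem stmt6 {B : Type*} [AddCommGroup B] (l : B → (B ≃+ B))
    (hhom : ∀ x y c : B, l (x + y) c = l x (l y c))
    (hinvar : ∀ x y c : B, l (l y x) c = l x c) :
    (∀ x y z : B, actMul l (actMul l x y) z = actMul l x (actMul l y z)) ∧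
    (∀ x : B, actMul l 0 x = x) ∧
    (∀ x : B, actMul l x 0 = x) ∧
    (∀ x : B, actMul l x (-(l x).symm x) = 0 ∧ actMul l (-(l x).symm x) x = 0) ∧
    (∀ x y z : B, actMul l x (y + z) = actMul l x y - x + actMul l x z) ∧
    rightSeries (actMul l) 2 = ⊥ := by
  refine ⟨fun x y z => ?_, fun x => ?_, fun x => ?_, fun x => ⟨?_, ?_⟩, fun x y z => ?_, ?_⟩
  · simp only [actMul, hhom, hinvar, map_add, add_assoc]
  · simp [actMul, action_zero l hhom]
  · simp [actMul]
  · simp [actMul]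
  · have h : l ((l x).symm x) ((l x).symm x) = x := by
      rw [← hinvar, AddEquiv.apply_symm_apply, AddEquiv.apply_symm_apply]
    rw [actMul, action_neg l hhom, (AddEquiv.symm_apply_eq _).2 h.symm, neg_add_cancel]
  · simp only [actMul, map_add]
    abel
  · change AddSubgroup.closure _ = ⊥
    rw [AddSubgroup.closure_eq_bot_iff]
    rintro _ ⟨z, c, hz, rfl⟩
    rw [Set.mem_singleton_iff, braceStar_actMul,
      action_eq_self_of_mem_rightSeries_one l hhom hinvar hz, sub_self]
end

section
/- Let (A,+,·) be a left brace with A^{(3)} = {0}. Then for every x,y,z ∈ A one has x*(z*y) + x*y + z*y = (x+z)*y and (x+z)*y = (x·z)*y. -/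
theorem braceLam_add {A : Type*} [AddCommGroup A] {mul : A → A → A}
    (hdist : ∀ a b c : A, mul a (b + c) = mul a b - a + mul a c) (a b c : A) :
    braceLam mul a (b + c) = braceLam mul a b + braceLam mul a c := by
  simp only [braceLam, hdist]
  abel

/-- If `A^{(3)} = 0`, then every star product acts trivially through `λ`. -/
theorem braceLam_braceStar_of_rightSeries_two {A : Type*} [AddCommGroup A] {mul : A → A → A}
    (h3 : rightSeries mul 2 = ⊥) (x z c : A) :
    braceLam mul (braceStar mul x z) c = c := by
  have hmem : braceStar mul x z ∈ rightSeries mul 1 :=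
    AddSubgroup.subset_closure ⟨x, z, AddSubgroup.mem_top x, rfl⟩
  have h : braceStar mul (braceStar mul x z) c ∈ rightSeries mul 2 :=
    AddSubgroup.subset_closure ⟨_, c, hmem, rfl⟩
  rw [h3, AddSubgroup.mem_bot] at h
  exact sub_eq_zero.mp h

/-- Let `A` be a left brace with `A^{(3)} = {0}`. Then for every `x, y, z ∈ A`,
`x*(z*y) + x*y + z*y = (x+z)*y` and `(x+z)*y = (x·z)*y`. -/
theorem stmt8 {A : Type*} [AddCommGroup A]
    (mul : A → A → A)
    (hassoc : ∀ a b c : A, mul (mul a b) c = mul a (mul b c))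
    (hzl : ∀ a : A, mul 0 a = a)
    (hzr : ∀ a : A, mul a 0 = a)
    (hinv : ∀ a : A, ∃ b : A, mul a b = 0 ∧ mul b a = 0)
    (hdist : ∀ a b c : A, mul a (b + c) = mul a b - a + mul a c)
    (h3 : rightSeries mul 2 = ⊥) :
    ∀ x y z : A,
      braceStar mul x (braceStar mul z y) + braceStar mul x y + braceStar mul z y =
        braceStar mul (x + z) y ∧
      braceStar mul (x + z) y = braceStar mul (mul x z) y := by
  intro x y z
  have hfix := braceLam_braceStar_of_rightSeries_two h3 x z
  have hmul : mul (braceStar mul x z) (x + z) = mul x z := by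
    have h := hfix (x + z)
    rw [braceLam, neg_add_eq_iff_eq_add] at h
    rw [h, braceStar, braceLam]
    abel
  have hlam : braceLam mul (mul x z) y = braceLam mul (x + z) y := by
    rw [← hmul, braceLam_mul hassoc hdist, hfix]
  have hstar : braceStar mul (x + z) y = braceStar mul (mul x z) y := by
    rw [braceStar, braceStar, hlam]
  refine ⟨?_, hstar⟩
  have h := braceLam_add hdist x (braceStar mul z y) y
  have hz : braceStar mul z y + y = braceLam mul z y := sub_add_cancel _ _
  rw [hz, ← braceLam_mul hassoc hdist] at h
  rw [hstar, braceStar.eq_1 mul (mul x z) y, h, braceStar.eq_1 mul x (braceStar mul z y),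
    braceStar.eq_1 mul x y]
  abel
end

section
/- Let (A,+,·) be a left brace with A^{(3)} = {0}. Then for every x,y ∈ A and every b ∈ A^{(2)}, one has (x+b)*y = x*y. -/
/-- Let `A` be a left brace with `A^{(3)} = {0}`. Then for every `x, y ∈ A` and
every `b ∈ A^{(2)}`, `(x+b)*y = x*y`. -/
theorem stmt9 {A : Type*} [AddCommGroup A]
    (mul : A → A → A)
    (hassoc : ∀ a b c : A, mul (mul a b) c = mul a (mul b c))
    (hzl : ∀ a : A, mul 0 a = a)
    (hzr : ∀ a : A, mul a 0 = a)
    (hinv : ∀ a : A, ∃ b : A, mul a b = 0 ∧ mul b a = 0)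
    (hdist : ∀ a b c : A, mul a (b + c) = mul a b - a + mul a c)
    (h3 : rightSeries mul 2 = ⊥) :
    ∀ x y : A, ∀ b ∈ rightSeries mul 1, braceStar mul (x + b) y = braceStar mul x y := by
  intro x y b hb
  have star_eq_zero : ∀ z ∈ rightSeries mul 1, ∀ c, braceStar mul z c = 0 := fun z hz c => by
    have hmem : braceStar mul z c ∈ rightSeries mul 2 :=
      AddSubgroup.subset_closure ⟨z, c, hz, rfl⟩
    rwa [h3, AddSubgroup.mem_bot] at hmem
  obtain ⟨x', hx, -⟩ := hinv x
  have hlam : braceLam mul x' b ∈ rightSeries mul 1 := by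
    have hstar : braceStar mul x' b ∈ rightSeries mul 1 :=
      AddSubgroup.subset_closure ⟨x', b, AddSubgroup.mem_top x', rfl⟩
    simpa [braceStar] using add_mem hstar hb
  have hmul : mul (braceLam mul x' b) y = braceLam mul x' b + y := by
    have h := star_eq_zero _ hlam y
    rw [braceStar, sub_eq_zero, braceLam, neg_add_eq_iff_eq_add] at h
    exact h
  have hneg : mul x (-x') = x + x := by
    have h := hdist x x' (-x')
    rw [add_neg_cancel, hzr, hx, zero_sub] at h
    exact (eq_neg_add_iff_add_eq.mp h).symm
  have hxb : mul x (braceLam mul x' b) = x + b := by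
    rw [braceLam, hdist, hneg, ← hassoc, hx, hzl, add_sub_cancel_right]
  have hkey : mul (x + b) y = b + mul x y := by
    rw [← hxb, hassoc, hmul, hdist, hxb, add_sub_cancel_left]
  rw [braceStar, braceStar, braceLam, braceLam, hkey]
  abel
end

section
/- Let (A,+,·) be a left brace with A^{(3)} = {0} and let a ∈ A. Define a_1 = a and a_{j+1} = a*a_j for j ≥ 1. Then for every positive integer n, a^n = ∑_{k=1}^n C(n,k)·a_k, where a^n is the n-th power of a in (A,·), C(n,k) is the binomial coefficient, and C(n,k)·a_k denotes the integer scalar multiple in (A,+). -/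
/-- In a left brace, `b ↦ a * b` is an additive endomorphism. -/
def braceStarHom {A : Type*} [AddCommGroup A] (mul : A → A → A)
    (hdist : ∀ a b c : A, mul a (b + c) = mul a b - a + mul a c) (a : A) : A →+ A :=
  AddMonoidHom.mk' (braceStar mul a) fun b c => by
    simp only [braceStar, braceLam, hdist]
    abel

/-- Pascal's rule for binomial sums of the iterates `D^k x` of an additive endomorphism `D`. -/
theorem sum_choose_succ_smul {A : Type*} [AddCommGroup A] (D : A →+ A) (g : ℕ → A)
    (hg : ∀ k, g (k + 1) = D (g k)) (n : ℕ) :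
    ∑ k ∈ Finset.range (n + 1), ((n + 1).choose (k + 1) : ℤ) • g k =
      g 0 + ∑ k ∈ Finset.range n, (n.choose (k + 1) : ℤ) • g k +
        D (∑ k ∈ Finset.range n, (n.choose (k + 1) : ℤ) • g k) := by
  simp only [Nat.choose_succ_succ, Nat.cast_add, add_smul, Finset.sum_add_distrib, map_sum,
    map_zsmul, ← hg]
  rw [Finset.sum_range_succ' (fun k => (n.choose k : ℤ) • g k),
    Finset.sum_range_succ (fun k => (n.choose (k + 1) : ℤ) • g k)]
  simp only [Nat.choose_zero_right, Nat.choose_succ_self, Nat.cast_one, Nat.cast_zero, one_smul,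
    zero_smul]
  abel

/-- Let `A` be a left brace with `A^{(3)} = {0}` and `a ∈ A`.  With `a_1 = a`,
`a_{j+1} = a * a_j` (the sequence `f`) and `a^n` the `n`-th power of `a` in `(A,·)` (the
sequence `p`), one has `a^n = ∑_{k=1}^n C(n,k)·a_k` for every positive integer `n`. -/
theorem stmt10 {A : Type*} [AddCommGroup A]
    (mul : A → A → A)
    (hassoc : ∀ a b c : A, mul (mul a b) c = mul a (mul b c))
    (hzl : ∀ a : A, mul 0 a = a)
    (hzr : ∀ a : A, mul a 0 = a)
    (hinv : ∀ a : A, ∃ b : A, mul a b = 0 ∧ mul b a = 0)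
    (hdist : ∀ a b c : A, mul a (b + c) = mul a b - a + mul a c)
    (h3 : rightSeries mul 2 = ⊥)
    (a : A) (f : ℕ → A) (hf1 : f 1 = a)
    (hf : ∀ j : ℕ, 1 ≤ j → f (j + 1) = braceStar mul a (f j))
    (p : ℕ → A) (hp0 : p 0 = 0) (hp : ∀ n : ℕ, p (n + 1) = mul a (p n)) :
    ∀ n : ℕ, 1 ≤ n → p n = ∑ k ∈ Finset.Icc 1 n, (n.choose k : ℤ) • f k := by
  have hsum : ∀ n, p n = ∑ k ∈ Finset.range n, (n.choose (k + 1) : ℤ) • f (k + 1) := by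
    intro n
    induction n with
    | zero => simpa using hp0
    | succ n ih =>
      rw [sum_choose_succ_smul (braceStarHom mul hdist a) (fun k => f (k + 1))
        (fun k => hf (k + 1) (Nat.le_add_left 1 k)) n, ← ih, hp, zero_add, hf1]
      simp only [braceStarHom, AddMonoidHom.mk'_apply, braceStar, braceLam]
      abel
  intro n _
  rw [hsum n, Finset.range_eq_Ico,
    Finset.sum_Ico_add' (fun k => (n.choose k : ℤ) • f k) 0 n 1]
  rfl
end

section
/- Let m ≥ 2 be a natural number and let B_m = ℤ^m (m-tuples of integers). Equip B_m with componentwise addition and with the multiplication (n_1,…,n_m)·(t_1,…,t_m) = (w_1,…,w_m) where w_i = n_i + ∑_{k=0}^{i−1} C(n_1,k)·t_{i−k} for 1 ≤ i ≤ m, with C(n_1,k) the generalized binomial coefficient. Then (B_m,+,·) is a left brace (· is associative, (0,…,0) is a two-sided identity, every element has a ·-inverse, and x·(y+z) = x·y − x + x·z), and B_m^{(3)} = {0}. -/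
/-- The multiplication of Theorem D on `B_m = ℤ^m` (here `m := m + 2 ≥ 2`, with coordinates
indexed from `0` to `m - 1` instead of `1` to `m`):
`(n·t)_i = n_i + ∑_{k=0}^{i} C(n_0, k) t_{i-k}`, where `C` is the generalized binomial
coefficient `Ring.choose`. -/
def bmul (m : ℕ) (n t : Fin (m + 2) → ℤ) : Fin (m + 2) → ℤ :=
  fun i => n i + ∑ k ∈ Finset.range (i.val + 1),
    Ring.choose (n 0) k * t ⟨i.val - k, Nat.lt_of_le_of_lt (Nat.sub_le _ _) i.isLt⟩

/-- The additive action of `a : ℤ` on `ℤ^(m+2)` by convolution with the binomial coefficients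
`C(a, k)`. -/
def binomialConv (m : ℕ) (a : ℤ) (t : Fin (m + 2) → ℤ) : Fin (m + 2) → ℤ :=
  fun i => ∑ k ∈ Finset.range (i.val + 1),
    Ring.choose a k * t ⟨i.val - k, Nat.lt_of_le_of_lt (Nat.sub_le _ _) i.isLt⟩

theorem bmul_eq_add_binomialConv (m : ℕ) (n t : Fin (m + 2) → ℤ) :
    bmul m n t = n + binomialConv m (n 0) t := rfl

theorem binomialConv_coeff (m : ℕ) (a : ℤ) (f : PowerSeries ℤ) :
    binomialConv m a (fun j => PowerSeries.coeff j.val f) =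
      fun i => PowerSeries.coeff i.val (PowerSeries.binomialSeries ℤ a * f) := by
  funext i
  simp [binomialConv, PowerSeries.coeff_mul,
    Finset.Nat.sum_antidiagonal_eq_sum_range_succ_mk]

theorem exists_powerSeries_coeff_eq (m : ℕ) (t : Fin (m + 2) → ℤ) :
    ∃ f : PowerSeries ℤ, t = fun j => PowerSeries.coeff j.val f :=
  ⟨PowerSeries.mk fun j => if h : j < m + 2 then t ⟨j, h⟩ else 0, by funext j; simp⟩

theorem binomialConv_add_left (m : ℕ) (a b : ℤ) (t : Fin (m + 2) → ℤ) :
    binomialConv m (a + b) t = binomialConv m a (binomialConv m b t) := by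
  obtain ⟨f, rfl⟩ := exists_powerSeries_coeff_eq m t
  simp only [binomialConv_coeff, PowerSeries.binomialSeries_add, mul_assoc]

theorem binomialConv_zero_left (m : ℕ) (t : Fin (m + 2) → ℤ) : binomialConv m 0 t = t := by
  obtain ⟨f, rfl⟩ := exists_powerSeries_coeff_eq m t
  simp only [binomialConv_coeff, PowerSeries.binomialSeries_zero, one_mul]

theorem binomialConv_add_right (m : ℕ) (a : ℤ) (s t : Fin (m + 2) → ℤ) :
    binomialConv m a (s + t) = binomialConv m a s + binomialConv m a t := by
  funext i
  simp [binomialConv, mul_add, Finset.sum_add_distrib]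

theorem binomialConv_zero_right (m : ℕ) (a : ℤ) : binomialConv m a 0 = 0 := by
  funext i
  simp [binomialConv]

theorem binomialConv_neg_right (m : ℕ) (a : ℤ) (t : Fin (m + 2) → ℤ) :
    binomialConv m a (-t) = -binomialConv m a t := by
  funext i
  simp [binomialConv]

theorem binomialConv_apply_zero (m : ℕ) (a : ℤ) (t : Fin (m + 2) → ℤ) :
    binomialConv m a t 0 = t 0 := by
  simp [binomialConv]

theorem braceStar_bmul (m : ℕ) (z c : Fin (m + 2) → ℤ) :
    braceStar (bmul m) z c = binomialConv m (z 0) c - c := by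
  simp [braceStar, braceLam, bmul_eq_add_binomialConv]

theorem apply_zero_of_mem_rightSeries_one (m : ℕ) {z : Fin (m + 2) → ℤ}
    (hz : z ∈ rightSeries (bmul m) 1) : z 0 = 0 := by
  suffices h : rightSeries (bmul m) 1 ≤
      (Pi.evalAddMonoidHom (fun _ : Fin (m + 2) => ℤ) 0).ker from h hz
  refine (AddSubgroup.closure_le _).2 ?_
  rintro x ⟨z, c, -, rfl⟩
  simp [AddMonoidHom.mem_ker, braceStar_bmul, binomialConv_apply_zero]

/-- part of Theorem D: For every `m ≥ 2` (encoded as `m + 2`), `B_m = ℤ^m`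
with componentwise addition and the multiplication `bmul` is a left brace (associative,
with `0` as two-sided identity, with `·`-inverses, satisfying the modified distributive
law), and `B_m^{(3)} = {0}`. -/
theorem stmt16 (m : ℕ) :
    (∀ x y z : Fin (m + 2) → ℤ, bmul m (bmul m x y) z = bmul m x (bmul m y z)) ∧
    (∀ x : Fin (m + 2) → ℤ, bmul m 0 x = x) ∧
    (∀ x : Fin (m + 2) → ℤ, bmul m x 0 = x) ∧
    (∀ x : Fin (m + 2) → ℤ, ∃ y : Fin (m + 2) → ℤ, bmul m x y = 0 ∧ bmul m y x = 0) ∧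
    (∀ x y z : Fin (m + 2) → ℤ, bmul m x (y + z) = bmul m x y - x + bmul m x z) ∧
    rightSeries (bmul m) 2 = ⊥ := by
  refine ⟨fun x y z => ?_, fun x => ?_, fun x => ?_, fun x => ?_, fun x y z => ?_, ?_⟩
  · simp only [bmul_eq_add_binomialConv, Pi.add_apply, binomialConv_apply_zero,
      binomialConv_add_left, binomialConv_add_right, add_assoc]
  · simp [bmul_eq_add_binomialConv, binomialConv_zero_left]
  · simp [bmul_eq_add_binomialConv, binomialConv_zero_right]
  · refine ⟨-binomialConv m (-x 0) x, ?_, ?_⟩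
    · rw [bmul_eq_add_binomialConv, binomialConv_neg_right, ← binomialConv_add_left,
        add_neg_cancel, binomialConv_zero_left, add_neg_cancel]
    · rw [bmul_eq_add_binomialConv, Pi.neg_apply, binomialConv_apply_zero, neg_add_cancel]
  · simp only [bmul_eq_add_binomialConv, binomialConv_add_right]
    abel
  · refine AddSubgroup.closure_eq_bot_iff.2 ?_
    rintro x ⟨z, c, hz, rfl⟩
    rw [Set.mem_singleton_iff, braceStar_bmul, apply_zero_of_mem_rightSeries_one m hz,
      binomialConv_zero_left, sub_self]
end

section
/- Let m ≥ 2 be a natural number and let B_m = ℤ^m with componentwise addition and the multiplication (n_1,…,n_m)·(t_1,…,t_m) = (w_1,…,w_m), w_i = n_i + ∑_{k=0}^{i−1} C(n_1,k)·t_{i−k}. Then for the left brace (B_m,+,·): B_m^{m+1} = {0}, B_m^{m} ≠ {0}, and B_m is generated as a left brace by b = (1,0,…,0), i.e. the only subbrace of B_m containing b is B_m itself. -/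
/-- `leftSeries mul r` is `A^{r+1}` of the paper: `leftSeries mul 0 = A^1 = A` and
`leftSeries mul (r+1) = A^{r+2} = A * A^{r+1}`, the additive subgroup generated by
star products of elements of `A` with elements of `A^{r+1}`. -/
def leftSeries {A : Type*} [AddCommGroup A] (mul : A → A → A) : ℕ → AddSubgroup A
  | 0 => ⊤
  | r + 1 => AddSubgroup.closure {x | ∃ c z, z ∈ leftSeries mul r ∧ x = braceStar mul c z}

/-- Coordinates of the star product: the `k = 0` term of `bmul` cancels. -/
theorem braceStar_bmul_apply (m : ℕ) (c z : Fin (m + 2) → ℤ) (i : Fin (m + 2)) :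
    braceStar (bmul m) c z i = ∑ k ∈ Finset.range i.val,
      Ring.choose (c 0) (k + 1) *
        z ⟨i.val - (k + 1), Nat.lt_of_le_of_lt (Nat.sub_le _ _) i.isLt⟩ := by
  simp only [braceStar, braceLam, bmul, Pi.sub_apply, Pi.add_apply, Pi.neg_apply,
    Finset.sum_range_succ', Ring.choose_zero_right, Nat.sub_zero, Fin.eta]
  ring

/-- Elements of `leftSeries (bmul m) r` vanish in the coordinates below `r`. -/
theorem apply_eq_zero_of_mem_leftSeries (m r : ℕ) :
    ∀ z ∈ leftSeries (bmul m) r, ∀ i : Fin (m + 2), i.val < r → z i = 0 := by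
  induction r with
  | zero => intro z _ i hi; omega
  | succ r ih =>
    intro z hz
    induction hz using AddSubgroup.closure_induction with
    | mem x hx =>
      obtain ⟨c, y, hy, rfl⟩ := hx
      intro i hi
      rw [braceStar_bmul_apply]
      refine Finset.sum_eq_zero fun k hk => ?_
      have hk' := Finset.mem_range.1 hk
      rw [ih y hy _ (by simp only; omega), mul_zero]
    | zero => intro i _; rfl
    | add x y _ _ hx hy => intro i hi; simp [hx i hi, hy i hi]
    | neg x _ hx => intro i hi; simp [hx i hi]

/-- The star product with `b = (1, 0, …, 0)` shifts the standard basis vectors. -/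
theorem braceStar_bmul_single (m j : ℕ) (hj : j + 1 < m + 2) :
    braceStar (bmul m) (Pi.single 0 1) (Pi.single ⟨j, by omega⟩ 1) =
      Pi.single ⟨j + 1, hj⟩ 1 := by
  ext i
  rw [braceStar_bmul_apply, Pi.single_eq_same]
  have hchoose (k : ℕ) : Ring.choose (1 : ℤ) (k + 1) = if k = 0 then 1 else 0 := by
    have h := Ring.choose_natCast (R := ℤ) 1 (k + 1)
    rw [Nat.cast_one] at h
    rw [h]
    cases k with
    | zero => simp
    | succ k => simp [Nat.choose_eq_zero_of_lt]
  simp only [hchoose, ite_mul, one_mul, zero_mul, Finset.sum_ite_eq', Finset.mem_range,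
    Pi.single_apply, Fin.ext_iff]
  split_ifs <;> first | rfl | omega

/-- part of Theorem D: For every `m ≥ 2` (encoded as `m + 2`), the left brace
`B_m = ℤ^m` with multiplication `bmul` satisfies `B_m^{m+1} = {0}` (here
`leftSeries (bmul m) (m + 2) = B_m^{(m+2)+1}` in the shifted indexing) and
`B_m^m = leftSeries (bmul m) (m + 1) ≠ {0}`, and `B_m` is generated as a left brace by
`b = (1, 0, …, 0)`: every subbrace of `B_m` containing `b` is all of `B_m`. -/
theorem stmt17 (m : ℕ) :
    leftSeries (bmul m) (m + 2) = ⊥ ∧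
    leftSeries (bmul m) (m + 1) ≠ ⊥ ∧
    (∀ S : AddSubgroup (Fin (m + 2) → ℤ),
      (∀ x ∈ S, ∀ y ∈ S, bmul m x y ∈ S) →
      (∀ x ∈ S, ∀ y, bmul m x y = 0 → bmul m y x = 0 → y ∈ S) →
      (fun i : Fin (m + 2) => if i = 0 then (1 : ℤ) else 0) ∈ S → S = ⊤) := by
  refine ⟨?_, ?_, ?_⟩
  · rw [eq_bot_iff]
    intro z hz
    rw [AddSubgroup.mem_bot]
    ext i
    exact apply_eq_zero_of_mem_leftSeries m (m + 2) z hz i i.isLt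
  · have hmem (r : ℕ) (hr : r < m + 2) :
        (Pi.single ⟨r, hr⟩ 1 : Fin (m + 2) → ℤ) ∈ leftSeries (bmul m) r := by
      induction r with
      | zero => exact AddSubgroup.mem_top _
      | succ r ih =>
        exact AddSubgroup.subset_closure
          ⟨Pi.single 0 1, _, ih (by omega), (braceStar_bmul_single m r hr).symm⟩
    intro h
    have h0 := hmem (m + 1) (by omega)
    rw [h, AddSubgroup.mem_bot, Pi.single_eq_zero_iff] at h0
    exact one_ne_zero h0
  · intro S hmul _ hb
    have hb' : (Pi.single 0 1 : Fin (m + 2) → ℤ) ∈ S := by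
      convert hb using 1
      ext i
      rw [Pi.single_apply]
    have hmem (r : ℕ) (hr : r < m + 2) : (Pi.single ⟨r, hr⟩ 1 : Fin (m + 2) → ℤ) ∈ S := by
      induction r with
      | zero => exact hb'
      | succ r ih =>
        have hr' := ih (by omega)
        rw [← braceStar_bmul_single m r hr]
        exact S.sub_mem (S.add_mem (S.neg_mem hb') (hmul _ hb' _ hr')) hr'
    rw [eq_top_iff]
    intro z _
    rw [← Finset.univ_sum_single z]
    refine S.sum_mem fun i _ => ?_
    have h := S.zsmul_mem (hmem i.val i.isLt) (z i)
    rwa [← Pi.single_smul, smul_eq_mul, mul_one] at h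
end

section
/- Let C = ⊕_{i∈ℤ} ℤ be the free abelian group of finitely supported functions ℤ → ℤ, with basis {c_i : i ∈ ℤ} (c_i the indicator of i). For x ∈ C let σ(x) = ∑_{j∈ℤ} x_j and define λ_x(y) to be the shift (λ_x(y))_i = y_{i−σ(x)}, and define x·y = x + λ_x(y). Then (C,+,·) is a left brace (· is associative, 0 is a two-sided identity, every element has a ·-inverse, and x·(y+z) = x·y − x + x·z), C^{(3)} = {0}, and C is generated as a left brace by c_0, i.e. the only subbrace of C containing c_0 is C itself. -/
/-- `σ(x) = ∑_{j ∈ ℤ} x_j` for a finitely supported `x : ℤ →₀ ℤ`. -/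
def csigma (x : ℤ →₀ ℤ) : ℤ := x.sum fun _ v => v

/-- The multiplication of Theorem B′ on `C = ⊕_{i ∈ ℤ} ℤ`: `x·y = x + λ_x(y)` where
`λ_x(y)` is the shift of `y` by `σ(x)`, i.e. `(λ_x(y))_i = y_{i - σ(x)}`. -/
noncomputable def cmul (x y : ℤ →₀ ℤ) : ℤ →₀ ℤ :=
  x + Finsupp.mapDomain (fun i => i + csigma x) y

theorem csigma_add (x y : ℤ →₀ ℤ) : csigma (x + y) = csigma x + csigma y :=
  Finsupp.sum_add_index' (fun _ => rfl) (fun _ _ _ => rfl)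

/-- `csigma` as an additive homomorphism. -/
noncomputable def csigmaHom : (ℤ →₀ ℤ) →+ ℤ := AddMonoidHom.mk' csigma csigma_add

theorem csigma_neg (x : ℤ →₀ ℤ) : csigma (-x) = -csigma x :=
  map_neg csigmaHom x

theorem csigma_sub (x y : ℤ →₀ ℤ) : csigma (x - y) = csigma x - csigma y :=
  map_sub csigmaHom x y

theorem csigma_single (i v : ℤ) : csigma (Finsupp.single i v) = v :=
  Finsupp.sum_single_index rfl

/-- The shift of a finitely supported function by `s`. -/
noncomputable def cshift (s : ℤ) : (ℤ →₀ ℤ) →+ (ℤ →₀ ℤ) :=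
  Finsupp.mapDomain.addMonoidHom (fun i => i + s)

theorem cmul_eq (x y : ℤ →₀ ℤ) : cmul x y = x + cshift (csigma x) y := rfl

theorem cshift_zero (x : ℤ →₀ ℤ) : cshift 0 x = x := by
  simp only [cshift, Finsupp.mapDomain.addMonoidHom_apply, add_zero]
  exact Finsupp.mapDomain_id

theorem cshift_cshift (s t : ℤ) (x : ℤ →₀ ℤ) : cshift s (cshift t x) = cshift (t + s) x := by
  simp only [cshift, Finsupp.mapDomain.addMonoidHom_apply, ← Finsupp.mapDomain_comp]
  congr 1
  funext i
  simp [add_assoc]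

theorem cshift_single (s i v : ℤ) :
    cshift s (Finsupp.single i v) = Finsupp.single (i + s) v :=
  Finsupp.mapDomain_single

theorem csigma_cshift (s : ℤ) (x : ℤ →₀ ℤ) : csigma (cshift s x) = csigma x :=
  Finsupp.sum_mapDomain_index (fun _ => rfl) (fun _ _ _ => rfl)

theorem braceStar_cmul (x y : ℤ →₀ ℤ) : braceStar cmul x y = cshift (csigma x) y - y := by
  simp [braceStar, braceLam, cmul_eq]

theorem csigma_eq_zero_of_mem_rightSeries {x : ℤ →₀ ℤ} (hx : x ∈ rightSeries cmul 1) :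
    csigma x = 0 := by
  have hle : rightSeries cmul 1 ≤ csigmaHom.ker := by
    refine (AddSubgroup.closure_le _).2 ?_
    rintro _ ⟨z, c, -, rfl⟩
    change csigma (braceStar cmul z c) = 0
    rw [braceStar_cmul, csigma_sub, csigma_cshift, sub_self]
  exact hle hx

theorem rightSeries_cmul_two : rightSeries cmul 2 = ⊥ := by
  refine AddSubgroup.closure_eq_bot_iff.2 ?_
  rintro _ ⟨z, c, hz, rfl⟩
  rw [Set.mem_singleton_iff, braceStar_cmul, csigma_eq_zero_of_mem_rightSeries hz, cshift_zero,
    sub_self]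

theorem eq_top_of_single_zero_mem (S : AddSubgroup (ℤ →₀ ℤ))
    (hmul : ∀ x ∈ S, ∀ y ∈ S, cmul x y ∈ S) (h0 : Finsupp.single (0 : ℤ) (1 : ℤ) ∈ S) :
    S = ⊤ := by
  have hshift : ∀ x ∈ S, ∀ y ∈ S, cshift (csigma x) y ∈ S := fun x hx y hy =>
    (S.add_mem_cancel_left hx).1 (hmul x hx y hy)
  have hbasis : ∀ i : ℤ, Finsupp.single i (1 : ℤ) ∈ S := by
    intro i
    induction i with
    | zero => exact h0
    | succ i ih => simpa [csigma_single, cshift_single] using hshift _ h0 _ ih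
    | pred i ih =>
      simpa only [csigma_neg, csigma_single, cshift_single, ← sub_eq_add_neg] using
        hshift _ (S.neg_mem h0) _ ih
  refine (AddSubgroup.eq_top_iff' S).2 fun x => ?_
  induction x using Finsupp.induction_linear with
  | zero => exact S.zero_mem
  | add f g hf hg => exact S.add_mem hf hg
  | single i v => simpa using S.zsmul_mem (hbasis i) v

/-- Let `C = ⊕_{i ∈ ℤ} ℤ` (finitely supported functions `ℤ → ℤ`) with basis
`{c_i}` (`c_i = Finsupp.single i 1`), and define `x·y = x + λ_x(y)` with `λ_x` the shift by
`σ(x)`.  Then `(C,+,·)` is a left brace (associative, with `0` as two-sided identity, with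
`·`-inverses, satisfying the modified distributive law), `C^{(3)} = {0}`, and `C` is
generated as a left brace by `c_0`: every subbrace of `C` containing `c_0` is all of `C`. -/
theorem stmt18 :
    (∀ x y z : ℤ →₀ ℤ, cmul (cmul x y) z = cmul x (cmul y z)) ∧
    (∀ x : ℤ →₀ ℤ, cmul 0 x = x) ∧
    (∀ x : ℤ →₀ ℤ, cmul x 0 = x) ∧
    (∀ x : ℤ →₀ ℤ, ∃ y : ℤ →₀ ℤ, cmul x y = 0 ∧ cmul y x = 0) ∧
    (∀ x y z : ℤ →₀ ℤ, cmul x (y + z) = cmul x y - x + cmul x z) ∧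
    rightSeries cmul 2 = ⊥ ∧
    (∀ S : AddSubgroup (ℤ →₀ ℤ),
      (∀ x ∈ S, ∀ y ∈ S, cmul x y ∈ S) →
      (∀ x ∈ S, ∀ y, cmul x y = 0 → cmul y x = 0 → y ∈ S) →
      Finsupp.single (0 : ℤ) (1 : ℤ) ∈ S → S = ⊤) := by
  refine ⟨fun x y z => ?_, fun x => ?_, fun x => ?_, fun x => ?_, fun x y z => ?_,
    rightSeries_cmul_two, fun S hmul _ h0 => eq_top_of_single_zero_mem S hmul h0⟩
  · simp only [cmul_eq, csigma_add, csigma_cshift, map_add, cshift_cshift, add_assoc,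
      add_comm (csigma y)]
  · rw [cmul_eq, zero_add]
    exact cshift_zero x
  · rw [cmul_eq, map_zero, add_zero]
  · refine ⟨-cshift (-csigma x) x, ?_, ?_⟩
    · simp [cmul_eq, cshift_cshift, cshift_zero]
    · simp [cmul_eq, csigma_neg, csigma_cshift]
  · simp only [cmul_eq, map_add]
    abel
end

section
/- Let C = ⊕_{i∈ℤ} ℤ be the free abelian group of finitely supported functions ℤ → ℤ with basis {c_i : i ∈ ℤ}, with the left brace multiplication x·y = x + λ_x(y), where (λ_x(y))_i = y_{i−σ(x)} and σ(x) = ∑_{j∈ℤ} x_j. Set a = c_0 and define s_1 = a, s_{j+1} = a*s_j for j ≥ 1. Then for every j ≥ 1, s_j = ∑_{k=0}^{j−1} (−1)^k C(j−1,k)·c_{j−1−k}; in particular s_j ≠ 0 and s_j ∈ C^j, so C^j ≠ {0} for every natural number j ≥ 1. -/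
/-- The shift `c_i ↦ c_{i+1}` as an additive endomorphism of `⊕_{i ∈ ℤ} ℤ`. -/
noncomputable def shiftEnd : Module.End ℤ (ℤ →₀ ℤ) :=
  Finsupp.lmapDomain ℤ ℤ fun i => i + 1

lemma shiftEnd_pow_single (n : ℕ) (i v : ℤ) :
    (shiftEnd ^ n) (Finsupp.single i v) = Finsupp.single (i + n) v := by
  induction n with
  | zero => simp
  | succ n ih =>
    rw [pow_succ', Module.End.mul_apply, ih]
    simp [shiftEnd, Finsupp.mapDomain_single, add_assoc]

lemma braceStar_cmul_single (y : ℤ →₀ ℤ) :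
    braceStar cmul (Finsupp.single 0 1) y = (-1 + shiftEnd) y := by
  simp [braceStar, braceLam, cmul, csigma, shiftEnd]
  abel

lemma neg_one_add_shiftEnd_pow_single (n : ℕ) :
    ((-1 + shiftEnd) ^ n) (Finsupp.single 0 1) =
      ∑ k ∈ Finset.range (n + 1),
        ((-1 : ℤ) ^ k * (n.choose k : ℤ)) • Finsupp.single (((n - k : ℕ) : ℤ)) (1 : ℤ) := by
  have hc : Commute (-1) shiftEnd := (Commute.one_left _).neg_left
  rw [hc.add_pow, LinearMap.sum_apply]
  refine Finset.sum_congr rfl fun k _ => ?_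
  have h : (-1 : Module.End ℤ (ℤ →₀ ℤ)) ^ k * shiftEnd ^ (n - k) * (n.choose k : Module.End ℤ _) =
      ((-1 : ℤ) ^ k * (n.choose k : ℤ)) • shiftEnd ^ (n - k) := by
    rw [zsmul_eq_mul, mul_assoc, ← (Nat.cast_commute (n.choose k) (shiftEnd ^ (n - k))).eq]
    push_cast
    rw [mul_assoc]
  rw [h, LinearMap.smul_apply, shiftEnd_pow_single, zero_add]

lemma neg_one_add_shiftEnd_pow_single_ne_zero (n : ℕ) :
    ((-1 + shiftEnd) ^ n) (Finsupp.single 0 1) ≠ 0 := by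
  intro h
  have h_coeff := DFunLike.congr_fun (neg_one_add_shiftEnd_pow_single n) (n : ℤ)
  rw [h, Finsupp.finsetSum_apply, Finset.sum_eq_single 0] at h_coeff
  · simp at h_coeff
  · intro k hk hk0
    have hne : ((n - k : ℕ) : ℤ) ≠ n := by
      have := Finset.mem_range.1 hk
      omega
    simp [hne]
  · simp

/-- In the left brace `C = ⊕_{i ∈ ℤ} ℤ` with `x·y = x + λ_x(y)` (`λ_x` the
shift by `σ(x)`), set `a = c_0 = Finsupp.single 0 1` and `s_1 = a`, `s_{j+1} = a * s_j`.
Then for every `j ≥ 1`, `s_j = ∑_{k=0}^{j-1} (-1)^k C(j-1,k)·c_{j-1-k}`, `s_j ≠ 0`, and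
`s_j ∈ C^j` (here `C^j = leftSeries cmul (j-1)`); consequently `C^j ≠ {0}` for every
`j ≥ 1`. -/
theorem stmt19 (s : ℕ → (ℤ →₀ ℤ)) (hs1 : s 1 = Finsupp.single (0 : ℤ) (1 : ℤ))
    (hs : ∀ j : ℕ, 1 ≤ j →
      s (j + 1) = braceStar cmul (Finsupp.single (0 : ℤ) (1 : ℤ)) (s j)) :
    (∀ j : ℕ, 1 ≤ j →
      s j = ∑ k ∈ Finset.range j,
        ((-1 : ℤ) ^ k * ((j - 1).choose k : ℤ)) • Finsupp.single (((j - 1 - k : ℕ) : ℤ)) (1 : ℤ) ∧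
      s j ≠ 0 ∧ s j ∈ leftSeries cmul (j - 1)) ∧
    (∀ j : ℕ, 1 ≤ j → leftSeries cmul (j - 1) ≠ ⊥) := by
  have h_pow : ∀ n : ℕ, s (n + 1) = ((-1 + shiftEnd) ^ n) (Finsupp.single 0 1) := by
    intro n
    induction n with
    | zero => simpa using hs1
    | succ n ih =>
      rw [hs (n + 1) n.succ_pos, braceStar_cmul_single, ih, pow_succ', Module.End.mul_apply]
  have h_ne : ∀ n : ℕ, s (n + 1) ≠ 0 := fun n =>
    h_pow n ▸ neg_one_add_shiftEnd_pow_single_ne_zero n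
  have h_mem : ∀ n : ℕ, s (n + 1) ∈ leftSeries cmul n := by
    intro n
    induction n with
    | zero => exact AddSubgroup.mem_top _
    | succ n ih => exact AddSubgroup.subset_closure ⟨_, _, ih, hs (n + 1) n.succ_pos⟩
  refine ⟨fun j hj => ?_, fun j hj h_bot => ?_⟩ <;>
    obtain ⟨n, rfl⟩ := Nat.exists_eq_add_of_le' hj
  · exact ⟨(h_pow n).trans (neg_one_add_shiftEnd_pow_single n), h_ne n, h_mem n⟩
  · have h := h_mem n
    rw [Nat.add_sub_cancel] at h_bot
    rw [h_bot, AddSubgroup.mem_bot] at h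
    exact h_ne n h
end
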